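/- Let V and E be finite types, src, tgt : E → V, w : E → ℤ, fix a source node s, let n = |V|, and let d : ℕ → V → WithTop ℤ be the Bellman-Ford distance function. If no negative-weight cycle is reachable from s, then the distances are stationary from step n − 1 onward: for every k ≥ n − 1 and every node v, d k v = d (n−1) v. -/

import Mathlib

namespace BFPaper

variable {V E : Type*}

/-- `IsWalk src tgt u v es` : the list of edges `es` forms a walk from `u` to `v`
in the directed multigraph given by source and target maps `src tgt : E → V`. -/
inductive IsWalk (src tgt : E → V) : V → V → List E → Prop
  | nil (u : V) : IsWalk src tgt u u []
  | cons {v : V} (e : E) {es : List E} (h : IsWalk src tgt (tgt e) v es) :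
      IsWalk src tgt (src e) v (e :: es)

/-- The weight of a walk: the sum of the weights of its edges. -/
def weight (w : E → ℤ) (es : List E) : ℤ := (es.map w).sum

/-- `v` is reachable from `s` if there is a walk from `s` to `v`. -/
def Reachable (src tgt : E → V) (s v : V) : Prop :=
  ∃ es : List E, IsWalk src tgt s v es

/-- There is a negative-weight cycle reachable from `s`. -/
def HasNegCycleFrom (src tgt : E → V) (w : E → ℤ) (s : V) : Prop :=
  ∃ (u : V) (es : List E), es ≠ [] ∧ IsWalk src tgt u u es ∧
    weight w es < 0 ∧ Reachable src tgt s u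

/-- The Bellman-Ford distance function `d : ℕ → V → WithTop ℤ`. -/
def bfDist [Fintype E] [DecidableEq V] (src tgt : E → V) (w : E → ℤ) (s : V) :
    ℕ → V → WithTop ℤ
  | 0 => fun v => if v = s then (0 : WithTop ℤ) else ⊤
  | (k+1) => fun v =>
      min (bfDist src tgt w s k v)
        (Finset.univ.inf fun e : E =>
          if tgt e = v then bfDist src tgt w s k (src e) + (w e : WithTop ℤ) else ⊤)

end BFPaper

namespace BFPaper

section Walks

variable {V E : Type*} {src tgt : E → V} {w : E → ℤ}

theorem IsWalk.append {u m v : V} {a b : List E} (ha : IsWalk src tgt u m a)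
    (hb : IsWalk src tgt m v b) : IsWalk src tgt u v (a ++ b) := by
  induction ha with
  | nil u => exact hb
  | cons e _ ih => exact IsWalk.cons e (ih hb)

theorem IsWalk.exists_of_append {v : V} {b : List E} : ∀ {a : List E} {u : V},
    IsWalk src tgt u v (a ++ b) → ∃ m, IsWalk src tgt u m a ∧ IsWalk src tgt m v b
  | [], u, h => ⟨u, .nil u, h⟩
  | e :: a, _, h => by
    rw [List.cons_append] at h
    cases h with
    | cons _ h =>
      obtain ⟨m, ha, hb⟩ := h.exists_of_append
      exact ⟨m, .cons e ha, hb⟩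

theorem IsWalk.target_unique {u v v' : V} {es : List E} (h : IsWalk src tgt u v es)
    (h' : IsWalk src tgt u v' es) : v = v' := by
  induction h with
  | nil u => cases h'; rfl
  | cons e _ ih =>
    generalize hx : src e = x at h'
    cases h' with
    | cons _ h' => exact ih h'

theorem weight_append (a b : List E) : weight w (a ++ b) = weight w a + weight w b := by
  simp [weight]

/-- A walk with at least `|V|` edges contains a nonempty closed subwalk. -/
theorem IsWalk.exists_closed_subwalk [Fintype V] {u v : V} {es : List E}
    (h : IsWalk src tgt u v es) (hl : Fintype.card V ≤ es.length) :
    ∃ (m : V) (a b c : List E), es = a ++ (b ++ c) ∧ b ≠ [] ∧ IsWalk src tgt u m a ∧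
      IsWalk src tgt m m b ∧ IsWalk src tgt m v c := by
  have hsplit (i : ℕ) :
      ∃ m, IsWalk src tgt u m (es.take i) ∧ IsWalk src tgt m v (es.drop i) :=
    IsWalk.exists_of_append (by rwa [List.take_append_drop])
  choose f hf hf' using hsplit
  obtain ⟨i, j, hij, hfij⟩ : ∃ i j : Fin (es.length + 1), i < j ∧ f i = f j := by
    obtain ⟨i, j, hne, he⟩ := Fintype.exists_ne_map_eq_of_card_lt
      (fun i : Fin (es.length + 1) => f i) (by simpa using Nat.lt_succ_of_le hl)
    rcases lt_or_gt_of_ne hne with hlt | hlt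
    · exact ⟨i, j, hlt, he⟩
    · exact ⟨j, i, hlt, he.symm⟩
  obtain ⟨i, hi⟩ := i
  obtain ⟨j, hj⟩ := j
  simp only [Fin.mk_lt_mk] at hij hfij
  obtain ⟨d, rfl⟩ := Nat.exists_eq_add_of_lt hij
  have hdrop : es.drop i = (es.drop i).take (d + 1) ++ es.drop (i + d + 1) := by
    conv_lhs => rw [← List.take_append_drop (d + 1) (es.drop i)]
    rw [List.drop_drop, add_assoc]
  have htake : es.take (i + d + 1) = es.take i ++ (es.drop i).take (d + 1) := by
    rw [add_assoc, List.take_add]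
  obtain ⟨m, hm, -⟩ := IsWalk.exists_of_append (hdrop ▸ hf' i)
  have hmi : m = f i := by
    rw [hfij]
    exact (htake ▸ (hf i).append hm).target_unique (hf _)
  subst hmi
  refine ⟨f i, es.take i, (es.drop i).take (d + 1), es.drop (i + d + 1), ?_, ?_, hf i, hm,
    hfij ▸ hf' _⟩
  · rw [← hdrop, List.take_append_drop]
  · apply List.ne_nil_of_length_pos
    rw [List.length_take, List.length_drop]
    omega

/-- Without reachable negative cycles, every walk from `s` can be replaced by one with fewer than
`|V|` edges that is not heavier. -/
theorem IsWalk.exists_short [Fintype V] {s v : V} (hnc : ¬ HasNegCycleFrom src tgt w s)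
    {es : List E} (h : IsWalk src tgt s v es) :
    ∃ es', IsWalk src tgt s v es' ∧ es'.length < Fintype.card V ∧
      weight w es' ≤ weight w es := by
  induction hn : es.length using Nat.strong_induction_on generalizing es with
  | _ n ih =>
    by_cases hl : es.length < Fintype.card V
    · exact ⟨es, h, hl, le_rfl⟩
    obtain ⟨m, a, b, c, rfl, hb, ha, hbm, hc⟩ := h.exists_closed_subwalk (not_lt.mp hl)
    have hpos := List.length_pos_iff.mpr hb
    obtain ⟨es', hw, hlen, hle⟩ :=
      ih (a ++ c).length (by simp only [List.length_append] at hn ⊢; omega) (ha.append hc) rfl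
    have hnonneg : 0 ≤ weight w b := by
      by_contra! hneg
      exact hnc ⟨m, b, hb, hbm, hneg, a, ha⟩
    refine ⟨es', hw, hlen, hle.trans ?_⟩
    simp only [weight_append]
    omega

end Walks

section Distances

variable {V E : Type*} [Fintype E] [DecidableEq V] {src tgt : E → V} {w : E → ℤ} {s : V}

theorem bfDist_antitone : Antitone (bfDist src tgt w s) :=
  antitone_nat_of_succ_le fun _ _ => min_le_left _ _

theorem bfDist_succ_le_edge (k : ℕ) (e : E) :
    bfDist src tgt w s (k + 1) (tgt e) ≤ bfDist src tgt w s k (src e) + (w e : WithTop ℤ) := by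
  refine (min_le_right _ _).trans ((Finset.inf_le (Finset.mem_univ e)).trans ?_)
  simp

theorem IsWalk.bfDist_length_le {v : V} {es : List E} (h : IsWalk src tgt s v es) :
    bfDist src tgt w s es.length v ≤ (weight w es : WithTop ℤ) := by
  induction es using List.reverseRecOn generalizing v with
  | nil => cases h; simp [bfDist, weight]
  | append_singleton es e ih =>
    obtain ⟨m, hm, he⟩ := h.exists_of_append
    cases he with
    | cons _ he =>
      obtain rfl := he.target_unique (.nil _)
      rw [List.length_append, weight_append]
      refine (bfDist_succ_le_edge _ e).trans ?_
      simpa [weight] using add_le_add_left (ih hm) (w e : WithTop ℤ)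

theorem exists_isWalk_weight_le_bfDist (k : ℕ) (v : V) (hv : bfDist src tgt w s k v ≠ ⊤) :
    ∃ es, IsWalk src tgt s v es ∧ (weight w es : WithTop ℤ) ≤ bfDist src tgt w s k v := by
  induction k generalizing v with
  | zero =>
    have hvs : v = s := by
      by_contra hne
      exact hv (if_neg hne)
    subst hvs
    exact ⟨[], .nil v, by simp [bfDist, weight]⟩
  | succ k ih =>
    set g : E → WithTop ℤ := fun e =>
      if tgt e = v then bfDist src tgt w s k (src e) + (w e : WithTop ℤ) else ⊤ with hg
    have hmin : bfDist src tgt w s (k + 1) v =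
        min (bfDist src tgt w s k v) (Finset.univ.inf g) := rfl
    rcases min_choice (bfDist src tgt w s k v) (Finset.univ.inf g) with hc | hc
    · rw [hmin, hc] at hv ⊢
      exact ih v hv
    · rw [hmin, hc] at hv ⊢
      have hne : (Finset.univ : Finset E).Nonempty := by
        rw [Finset.nonempty_iff_ne_empty]
        intro hempty
        exact hv (by rw [hempty, Finset.inf_empty])
      obtain ⟨e, -, he⟩ := Finset.exists_mem_eq_inf _ hne g
      rw [he] at hv ⊢
      by_cases hev : tgt e = v
      · subst hev
        simp only [hg, if_true] at hv ⊢
        obtain ⟨es, hes, hle⟩ := ih (src e) fun htop => hv (by rw [htop, WithTop.top_add])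
        refine ⟨es ++ [e], hes.append (.cons e (.nil _)), ?_⟩
        simpa [weight] using add_le_add_left hle (w e : WithTop ℤ)
      · exact absurd (if_neg hev) hv

end Distances

end BFPaper

/-- If no negative-weight cycle is reachable from `s`, the Bellman-Ford distances
are stationary from step `|V| - 1` onward. -/
theorem bfDist_stationary_of_no_negCycle
    (V E : Type*) [Fintype V] [Fintype E] [DecidableEq V]
    (src tgt : E → V) (w : E → ℤ) (s : V)
    (hnc : ¬ BFPaper.HasNegCycleFrom src tgt w s) :
    ∀ k : ℕ, Fintype.card V - 1 ≤ k → ∀ v : V,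
      BFPaper.bfDist src tgt w s k v =
        BFPaper.bfDist src tgt w s (Fintype.card V - 1) v := by
  intro k hk v
  refine le_antisymm (BFPaper.bfDist_antitone hk v) ?_
  by_cases hv : BFPaper.bfDist src tgt w s k v = ⊤
  · exact hv ▸ le_top
  obtain ⟨es, hes, hle⟩ := BFPaper.exists_isWalk_weight_le_bfDist k v hv
  obtain ⟨es', hes', hlen, hle'⟩ := hes.exists_short hnc
  calc BFPaper.bfDist src tgt w s (Fintype.card V - 1) v
      ≤ BFPaper.bfDist src tgt w s es'.length v :=
        BFPaper.bfDist_antitone (Nat.le_sub_one_of_lt hlen) v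
    _ ≤ (BFPaper.weight w es' : WithTop ℤ) := hes'.bfDist_length_le
    _ ≤ (BFPaper.weight w es : WithTop ℤ) := WithTop.coe_le_coe.mpr hle'
    _ ≤ BFPaper.bfDist src tgt w s k v := hle
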